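/- Let X be a real Hilbert space, (𝒫,d₁) a metric space, and let g : X × 𝒫 → ℝ ∪ {+∞} with v̂ ∈ ∂_x g(x̄,p̄) satisfy (A2) and (A3), with threshold of prox-regularity ℛ. Then the following are equivalent: (i) for every λ ∈ (0,ℛ^{-1}), the proximal mapping P_λ admits a single-valued localization π_λ relative to a neighborhood W × P × U of (λv̂ + x̄, p̄, x̄) such that for some κ₀, ℓ₀ > 0: ‖(v₁−v₂) − 2κ₀[π_λ(v₁,p₁) − π_λ(v₂,p₂)]‖ ≤ ‖v₁−v₂‖ + ℓ₀ d₁(p₁,p₂) for all (v₁,p₁),(v₂,p₂) ∈ W × P; (ii) the set-valued map p ↦ gph ∂_x g(·,p) ⊂ X × X is Lipschitz-like around (p̄,(x̄,v̂)). -/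

import Mathlib

noncomputable section

open Filter Topology Metric Set MeasureTheory
open scoped RealInnerProductSpace Pointwise

namespace PVS

variable {X : Type*} [NormedAddCommGroup X] [InnerProductSpace ℝ X]
variable {Y : Type*} [NormedAddCommGroup Y] [InnerProductSpace ℝ Y]
variable {W : Type*} [NormedAddCommGroup W] [InnerProductSpace ℝ W]
variable {P : Type*} [MetricSpace P]
variable {Q : Type*} [MetricSpace Q]

/-- Regular (Fréchet) subdifferential of an extended-real-valued function. -/
def regSubdiff (h : X → EReal) (x : X) : Set X :=
  {v | h x ≠ ⊤ ∧ h x ≠ ⊥ ∧ ∀ ε > (0:ℝ), ∀ᶠ u in 𝓝 x,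
      h x + ((⟪v, u - x⟫ - ε * ‖u - x‖ : ℝ) : EReal) ≤ h u}

/-- Weak sequential convergence in an inner product space. -/
def WeakTendsto (xs : ℕ → X) (x : X) : Prop :=
  ∀ z : X, Tendsto (fun k => ⟪xs k, z⟫) atTop (𝓝 ⟪x, z⟫)

/-- Limiting (Mordukhovich) subdifferential. -/
def limSubdiff (h : X → EReal) (x : X) : Set X :=
  {v | ∃ xs vs : ℕ → X, Tendsto xs atTop (𝓝 x) ∧
      Tendsto (fun k => h (xs k)) atTop (𝓝 (h x)) ∧
      (∀ k, vs k ∈ regSubdiff h (xs k)) ∧ WeakTendsto vs v}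

/-- Partial limiting subdifferential with respect to the first variable. -/
def pSubdiff {PP : Type*} (g : X → PP → EReal) (x : X) (p : PP) : Set X :=
  limSubdiff (fun x' => g x' p) x

/-- Graph of a set-valued map. -/
def gph (F : X → Set Y) : Set (X × Y) := {t | t.2 ∈ F t.1}

/-- Regular normal cone. -/
def regNC (Ω : Set X) (x : X) : Set X :=
  {v | ∀ ε > (0:ℝ), ∀ᶠ y in 𝓝[Ω] x, ⟪v, y - x⟫ ≤ ε * ‖y - x‖}

/-- Limiting normal cone. -/
def limNC (Ω : Set X) (x : X) : Set X :=
  {v | ∃ xs vs : ℕ → X, (∀ k, xs k ∈ Ω) ∧ Tendsto xs atTop (𝓝 x) ∧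
      (∀ k, vs k ∈ regNC Ω (xs k)) ∧ Tendsto vs atTop (𝓝 v)}

/-- Regular normal cone to a subset of a product of two inner product spaces,
with the Euclidean product norm. -/
def regNC2 (Ω : Set (X × Y)) (ω : X × Y) : Set (X × Y) :=
  {ζ | ∀ ε > (0:ℝ), ∀ᶠ y in 𝓝[Ω] ω,
      ⟪ζ.1, y.1 - ω.1⟫ + ⟪ζ.2, y.2 - ω.2⟫
        ≤ ε * Real.sqrt (‖y.1 - ω.1‖ ^ 2 + ‖y.2 - ω.2‖ ^ 2)}

/-- Limiting normal cone in a product of two spaces. -/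
def limNC2 (Ω : Set (X × Y)) (ω : X × Y) : Set (X × Y) :=
  {ζ | ∃ ωs ζs : ℕ → X × Y, (∀ k, ωs k ∈ Ω) ∧ Tendsto ωs atTop (𝓝 ω) ∧
      (∀ k, ζs k ∈ regNC2 Ω (ωs k)) ∧ Tendsto ζs atTop (𝓝 ζ)}

/-- Regular coderivative of a set-valued map. -/
def regCoderiv (F : X → Set Y) (u : X) (v : Y) (w : Y) : Set X :=
  {z | (z, -w) ∈ regNC2 (gph F) (u, v)}

/-- Limiting coderivative of a set-valued map. -/
def limCoderiv (F : X → Set Y) (u : X) (v : Y) (w : Y) : Set X :=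
  {z | (z, -w) ∈ limNC2 (gph F) (u, v)}

/-- Regular normal cone in a product of three inner product spaces. -/
def regNC3 (Ω : Set (X × W × Y)) (ω : X × W × Y) : Set (X × W × Y) :=
  {ζ | ∀ ε > (0:ℝ), ∀ᶠ y in 𝓝[Ω] ω,
      ⟪ζ.1, y.1 - ω.1⟫ + ⟪ζ.2.1, y.2.1 - ω.2.1⟫ + ⟪ζ.2.2, y.2.2 - ω.2.2⟫
        ≤ ε * Real.sqrt (‖y.1 - ω.1‖ ^ 2 + ‖y.2.1 - ω.2.1‖ ^ 2 + ‖y.2.2 - ω.2.2‖ ^ 2)}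

/-- Limiting normal cone in a product of three inner product spaces. -/
def limNC3 (Ω : Set (X × W × Y)) (ω : X × W × Y) : Set (X × W × Y) :=
  {ζ | ∃ ωs ζs : ℕ → X × W × Y, (∀ k, ωs k ∈ Ω) ∧ Tendsto ωs atTop (𝓝 ω) ∧
      (∀ k, ζs k ∈ regNC3 Ω (ωs k)) ∧ Tendsto ζs atTop (𝓝 ζ)}

/-- Limiting coderivative of the full partial subdifferential map (x,p) ↦ ∂ₓ g(x,p). -/
def limCoderivFull (g : X → W → EReal) (xb : X) (pb : W) (vh : X) (w : X) : Set (X × W) :=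
  {zs | (zs.1, zs.2, -w) ∈ limNC3 {t : X × W × X | t.2.2 ∈ pSubdiff g t.1 t.2.1} (xb, pb, vh)}

/-- Lipschitz-like (Aubin) property of a set-valued map around a graph point. -/
def LipschitzLike {α Z : Type*} [MetricSpace α] [SeminormedAddCommGroup Z]
    (F : α → Set Z) (ab : α) (zb : Z) : Prop :=
  ∃ ℓ > (0:ℝ), ∃ U ∈ 𝓝 ab, ∃ V ∈ 𝓝 zb,
    ∀ a ∈ U, ∀ a' ∈ U, ∀ z ∈ F a ∩ V, ∃ z' ∈ F a', ‖z - z'‖ ≤ ℓ * dist a a'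

/-- Epigraph of g(·,p). -/
def epi {PP : Type*} (g : X → PP → EReal) (p : PP) : Set (X × ℝ) :=
  {q | g q.1 p ≤ (q.2 : EReal)}

/-- (A1): Lipschitz continuity of the base around the reference point. -/
def A1 (f : X → P → Q → X) (xb : X) (pb : P) (qb : Q) : Prop :=
  ∃ L > (0:ℝ), ∃ ε > (0:ℝ), ∀ x₁ x₂ p₁ p₂ q₁ q₂,
    ‖x₁ - xb‖ < ε → ‖x₂ - xb‖ < ε → dist p₁ pb < ε → dist p₂ pb < ε →
    dist q₁ qb < ε → dist q₂ qb < ε →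
    ‖f x₁ p₁ q₁ - f x₂ p₂ q₂‖ ≤ L * (‖x₁ - x₂‖ + dist p₁ p₂ + dist q₁ q₂)

/-- Parametric prox-regularity with prox-parameter r. -/
def ProxRegWith (g : X → P → EReal) (xb : X) (pb : P) (vh : X) (r : ℝ) : Prop :=
  ∃ ε > (0:ℝ), ∀ x u p v, ‖x - xb‖ < ε → ‖u - xb‖ < ε → dist p pb < ε → ‖v - vh‖ < ε →
    v ∈ pSubdiff g u p →
    g u p + ((⟪v, x - u⟫ - r / 2 * ‖x - u‖ ^ 2 : ℝ) : EReal) ≤ g x p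

/-- Subdifferential continuity with compatible parameterization. -/
def SubdiffCont (g : X → P → EReal) (xb : X) (pb : P) (vh : X) : Prop :=
  Tendsto (fun t : X × P × X => g t.1 t.2.1)
    (𝓝[{t : X × P × X | t.2.2 ∈ pSubdiff g t.1 t.2.1}] (xb, pb, vh)) (𝓝 (g xb pb))

/-- (A2): parametric continuous prox-regularity. -/
def A2 (g : X → P → EReal) (xb : X) (pb : P) (vh : X) : Prop :=
  (∃ r > (0:ℝ), ProxRegWith g xb pb vh r) ∧ SubdiffCont g xb pb vh

/-- Threshold of prox-regularity. -/
def proxThreshold (g : X → P → EReal) (xb : X) (pb : P) (vh : X) : ℝ :=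
  sInf {r : ℝ | 0 < r ∧ ProxRegWith g xb pb vh r}

/-- (A3): basic constraint qualification. -/
def A3 (g : X → P → EReal) (xb : X) (pb : P) : Prop :=
  LipschitzLike (fun p => epi g p) pb (xb, (g xb pb).toReal)

/-- (A4): uniform partial differentiability with partial Jacobian continuous at the point. -/
def A4 (f : X → P → Q → X) (Df : X → P → Q → X →L[ℝ] X) (xb : X) (pb : P) (qb : Q) : Prop :=
  (∃ η > (0:ℝ), ∀ ε > (0:ℝ), ∃ δ > (0:ℝ), ∀ x p q,
      ‖x - xb‖ < η → dist p pb < η → dist q qb < η →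
      ∀ x', ‖x' - x‖ < δ →
        ‖f x' p q - f x p q - Df x p q (x' - x)‖ ≤ ε * ‖x' - x‖) ∧
  Tendsto (fun t : X × P × Q => Df t.1 t.2.1 t.2.2) (𝓝 (xb, pb, qb)) (𝓝 (Df xb pb qb))

/-- Solution map of the parametric variational system. -/
def SolMap (f : X → P → Q → X) (g : X → P → EReal) (v : X) (p : P) (q : Q) : Set X :=
  {x | v - f x p q ∈ pSubdiff g x p}

/-- Single-valued localization of a three-parametric solution map. -/
def Localizes3 (S : X → P → Q → Set X) (V : Set X) (Pn : Set P) (Qn : Set Q) (U : Set X)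
    (ϑ : X → P → Q → X) : Prop :=
  ∀ v ∈ V, ∀ p ∈ Pn, ∀ q ∈ Qn,
    ϑ v p q ∈ U ∧ ϑ v p q ∈ S v p q ∧ ∀ x ∈ U, x ∈ S v p q → x = ϑ v p q

/-- Lipschitzian full stability. -/
def LipFullStable (S : X → P → Q → Set X) (xb vb : X) (pb : P) (qb : Q) : Prop :=
  ∃ V ∈ 𝓝 vb, ∃ Pn ∈ 𝓝 pb, ∃ Qn ∈ 𝓝 qb, ∃ U ∈ 𝓝 xb, ∃ ϑ : X → P → Q → X,
    Localizes3 S V Pn Qn U ϑ ∧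
    ∃ κ > (0:ℝ), ∃ ℓ > (0:ℝ), ∀ v₁ ∈ V, ∀ p₁ ∈ Pn, ∀ q₁ ∈ Qn, ∀ v₂ ∈ V, ∀ p₂ ∈ Pn, ∀ q₂ ∈ Qn,
      ‖(v₁ - v₂) - (2 * κ) • (ϑ v₁ p₁ q₁ - ϑ v₂ p₂ q₂)‖
        ≤ ‖v₁ - v₂‖ + ℓ * (dist p₁ p₂ + dist q₁ q₂)

/-- Hölderian full stability with given moduli. -/
def HolderFullStableWith (S : X → P → Q → Set X) (xb vb : X) (pb : P) (qb : Q) (κ ℓ : ℝ) : Prop :=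
  ∃ V ∈ 𝓝 vb, ∃ Pn ∈ 𝓝 pb, ∃ Qn ∈ 𝓝 qb, ∃ U ∈ 𝓝 xb, ∃ ϑ : X → P → Q → X,
    Localizes3 S V Pn Qn U ϑ ∧
    ∀ v₁ ∈ V, ∀ p₁ ∈ Pn, ∀ q₁ ∈ Qn, ∀ v₂ ∈ V, ∀ p₂ ∈ Pn, ∀ q₂ ∈ Qn,
      ‖(v₁ - v₂) - (2 * κ) • (ϑ v₁ p₁ q₁ - ϑ v₂ p₂ q₂)‖
        ≤ ‖v₁ - v₂‖ + ℓ * (Real.sqrt (dist p₁ p₂) + dist q₁ q₂)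

/-- Hölderian full stability. -/
def HolderFullStable (S : X → P → Q → Set X) (xb vb : X) (pb : P) (qb : Q) : Prop :=
  ∃ κ > (0:ℝ), ∃ ℓ > (0:ℝ), HolderFullStableWith S xb vb pb qb κ ℓ

/-- Neighborhood second-order condition via the regular coderivative of ∂g_p. -/
def SOC (g : X → P → EReal) (A : X →L[ℝ] X) (xb : X) (pb : P) (vh : X) (η κ₀ : ℝ) : Prop :=
  ∀ u p v, ‖u - xb‖ ≤ η → dist p pb ≤ η → ‖v - vh‖ ≤ η → v ∈ pSubdiff g u p →
    ∀ w z, z ∈ regCoderiv (fun y => pSubdiff g y p) u v w →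
      κ₀ * ‖w‖ ^ 2 ≤ ⟪A w, w⟫ + ⟪z, w⟫

/-- The graphical map p ↦ gph ∂ₓ g(·,p). -/
def gphMap (g : X → P → EReal) (p : P) : Set (X × X) := {t | t.2 ∈ pSubdiff g t.1 p}

/-- Local strong monotonicity of f in x with modulus σ. -/
def StrongMono (f : X → P → Q → X) (xb : X) (pb : P) (qb : Q) (σ : ℝ) : Prop :=
  ∃ ε > (0:ℝ), ∀ x₁ x₂ p q, ‖x₁ - xb‖ < ε → ‖x₂ - xb‖ < ε → dist p pb < ε → dist q qb < ε →
    σ * ‖x₁ - x₂‖ ^ 2 ≤ ⟪f x₁ p q - f x₂ p q, x₁ - x₂⟫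

/-- The proximal mapping P_λ(v,p) = {x : v ∈ x + λ ∂ₓ g(x,p)}. -/
def proxMap (g : X → P → EReal) (lam : ℝ) (v : X) (p : P) : Set X :=
  {x | ∃ s ∈ pSubdiff g x p, v = x + lam • s}

/-- Single-valued localization of a two-parametric solution map. -/
def Localizes2 (S : X → P → Set X) (V : Set X) (Pn : Set P) (U : Set X) (ϑ : X → P → X) : Prop :=
  ∀ v ∈ V, ∀ p ∈ Pn, ϑ v p ∈ U ∧ ϑ v p ∈ S v p ∧ ∀ x ∈ U, x ∈ S v p → x = ϑ v p

/-- (Lipschitzian) full stability of a two-parametric system. -/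
def FullStable2 (S : X → P → Set X) (xb vb : X) (pb : P) : Prop :=
  ∃ V ∈ 𝓝 vb, ∃ Pn ∈ 𝓝 pb, ∃ U ∈ 𝓝 xb, ∃ ϑ : X → P → X,
    Localizes2 S V Pn U ϑ ∧
    ∃ κ > (0:ℝ), ∃ ℓ > (0:ℝ), ∀ v₁ ∈ V, ∀ p₁ ∈ Pn, ∀ v₂ ∈ V, ∀ p₂ ∈ Pn,
      ‖(v₁ - v₂) - (2 * κ) • (ϑ v₁ p₁ - ϑ v₂ p₂)‖ ≤ ‖v₁ - v₂‖ + ℓ * dist p₁ p₂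

/-- Normal cone of convex analysis. -/
def convNC (C : Set X) (x : X) : Set X := {v | x ∈ C ∧ ∀ y ∈ C, ⟪v, y - x⟫ ≤ 0}

/-- Solution map of a parametric variational inequality. -/
def SolMapVI (f : X → P → X) (C : Set X) (v : X) (p : P) : Set X :=
  {x | v - f x p ∈ convNC C x}

/-- Radial cone. -/
def radialCone (C : Set X) (x : X) : Set X := {w | ∃ t > (0:ℝ), x + t • w ∈ C}

/-- Tangent cone (closure of the radial cone). -/
def tangentC (C : Set X) (x : X) : Set X := closure (radialCone C x)

/-- Critical cone. -/
def criticalCone (C : Set X) (x v : X) : Set X := tangentC C x ∩ {w | ⟪v, w⟫ = 0}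

/-- Polyhedricity of a closed convex set. -/
def Polyhedric (C : Set X) : Prop :=
  ∀ x ∈ C, ∀ v ∈ convNC C x,
    criticalCone C x v = closure (radialCone C x ∩ {w | ⟪v, w⟫ = 0})

/-- Weak sequential outer limit of critical cones. -/
def Hw (C : Set X) (xb vh : X) : Set X :=
  {w | ∃ xs vs ws : ℕ → X, (∀ k, vs k ∈ convNC C (xs k)) ∧
      Tendsto xs atTop (𝓝 xb) ∧ Tendsto vs atTop (𝓝 vh) ∧
      (∀ k, ws k ∈ criticalCone C (xs k) (vs k)) ∧ WeakTendsto ws w}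

/-- Strong sequential outer limit of critical cones. -/
def Hs (C : Set X) (xb vh : X) : Set X :=
  {w | ∃ xs vs ws : ℕ → X, (∀ k, vs k ∈ convNC C (xs k)) ∧
      Tendsto xs atTop (𝓝 xb) ∧ Tendsto vs atTop (𝓝 vh) ∧
      (∀ k, ws k ∈ criticalCone C (xs k) (vs k)) ∧ Tendsto ws atTop (𝓝 w)}

/-- Convex polyhedron: finite intersection of closed half-spaces. -/
def IsPolyhedron (C : Set X) : Prop :=
  ∃ (k : ℕ) (a : Fin k → X) (b : Fin k → ℝ), C = {x | ∀ i, ⟪a i, x⟫ ≤ b i}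

/-- Legendre form. -/
def LegendreForm (Qf : X → ℝ) : Prop :=
  (∃ A : X →L[ℝ] X, ∀ x, Qf x = ⟪A x, x⟫) ∧
  (∀ (xs : ℕ → X) (x : X), WeakTendsto xs x → Qf x ≤ liminf (fun k => Qf (xs k)) atTop) ∧
  (∀ (xs : ℕ → X) (x : X), WeakTendsto xs x →
     Tendsto (fun k => Qf (xs k)) atTop (𝓝 (Qf x)) → Tendsto xs atTop (𝓝 x))

/-- (A1) for a two-parametric base mapping. -/
def A1two (f : X → P → X) (xb : X) (pb : P) : Prop :=
  ∃ L > (0:ℝ), ∃ ε > (0:ℝ), ∀ x₁ x₂ p₁ p₂,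
    ‖x₁ - xb‖ < ε → ‖x₂ - xb‖ < ε → dist p₁ pb < ε → dist p₂ pb < ε →
    ‖f x₁ p₁ - f x₂ p₂‖ ≤ L * (‖x₁ - x₂‖ + dist p₁ p₂)

/-- (A4) for a two-parametric base mapping. -/
def A4two (f : X → P → X) (Df : X → P → X →L[ℝ] X) (xb : X) (pb : P) : Prop :=
  (∃ η > (0:ℝ), ∀ ε > (0:ℝ), ∃ δ > (0:ℝ), ∀ x p,
      ‖x - xb‖ < η → dist p pb < η →
      ∀ x', ‖x' - x‖ < δ → ‖f x' p - f x p - Df x p (x' - x)‖ ≤ ε * ‖x' - x‖) ∧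
  Tendsto (fun t : X × P => Df t.1 t.2) (𝓝 (xb, pb)) (𝓝 (Df xb pb))

/-- Euclidean distance in X × ℝ. -/
def pairDist (a b : X × ℝ) : ℝ := Real.sqrt (‖a.1 - b.1‖ ^ 2 + |a.2 - b.2| ^ 2)

/-- Pompeiu–Hausdorff distance between subsets of X × ℝ (Euclidean product norm). -/
def hausPH (C₁ C₂ : Set (X × ℝ)) : ℝ :=
  sInf {η : ℝ | 0 ≤ η ∧ (∀ a ∈ C₁, ∃ b ∈ C₂, pairDist a b ≤ η) ∧
                 ∀ b ∈ C₂, ∃ a ∈ C₁, pairDist a b ≤ η}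

/-- Nonparametric prox-regularity with parameter r. -/
def ProxRegWithNP (g : X → EReal) (xb vh : X) (r : ℝ) : Prop :=
  ∃ ε > (0:ℝ), ∀ x u v, ‖x - xb‖ < ε → ‖u - xb‖ < ε → ‖v - vh‖ < ε →
    v ∈ limSubdiff g u → g u ≤ g xb + (ε : EReal) →
    g u + ((⟪v, x - u⟫ - r / 2 * ‖x - u‖ ^ 2 : ℝ) : EReal) ≤ g x

/-- Nonparametric subdifferential continuity. -/
def SubdiffContNP (g : X → EReal) (xb vh : X) : Prop :=
  Tendsto (fun t : X × X => g t.1) (𝓝[gph (limSubdiff g)] (xb, vh)) (𝓝 (g xb))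

/-- Nonparametric threshold of prox-regularity. -/
def proxThresholdNP (g : X → EReal) (xb vh : X) : ℝ :=
  sInf {r : ℝ | 0 < r ∧ ProxRegWithNP g xb vh r}


/-- A bounded-below lower semicontinuous function on a bounded set becomes attained after adding
a quadratic `μ ‖· - w'‖ ^ 2`, for a dense set of centers `w'`. -/
theorem exists_center_minimizer_real [CompleteSpace X] {C : Set X} (hne : C.Nonempty) {R : ℝ}
    (hR : ∀ x ∈ C, ‖x‖ ≤ R) (f : X → ℝ) {m : ℝ} (hm : ∀ x ∈ C, m ≤ f x)
    (hcl : ∀ t, IsClosed {x | x ∈ C ∧ f x ≤ t}) {μ : ℝ} (hμ : 0 < μ) (w : X)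
    {η : ℝ} (hη : 0 < η) :
    ∃ w', ‖w' - w‖ ≤ η ∧ ∃ x ∈ C, ∀ y ∈ C, f x + μ * ‖x - w'‖ ^ 2 ≤ f y + μ * ‖y - w'‖ ^ 2 := by
  obtain ⟨x₀, hx₀⟩ := hne
  have hR0 : 0 ≤ R := (norm_nonneg _).trans (hR x₀ hx₀)
  set δ : ℝ := μ * η / (R + 1) with hδ
  have hδ0 : 0 < δ := by positivity
  have hδR : δ * R ≤ μ * η := by
    rw [hδ, div_mul_eq_mul_div, div_le_iff₀ (by positivity)]
    have := mul_pos hμ hη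
    nlinarith
  let F : ℕ → X → X → ℝ := fun n a y => f y + (μ - δ / 2 ^ n) * ‖y‖ ^ 2 - 2 * ⟪y, a⟫
  have pick : ∀ (n : ℕ) (a : X) (x : C), ∃ z : C, F n a z ≤ F n a x ∧
      ∀ y ∈ C, F n a z ≤ F n a y + δ / 2 ^ (n + 1) / 4 ^ n := by
    intro n a x
    have hbdd : BddBelow (F n a '' C) := by
      refine ⟨m - |μ - δ / 2 ^ n| * R ^ 2 - 2 * (R * ‖a‖), ?_⟩
      rintro _ ⟨y, hy, rfl⟩
      have h1 := hm y hy
      have h2 : ⟪y, a⟫ ≤ R * ‖a‖ := (real_inner_le_norm y a).trans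
        (mul_le_mul_of_nonneg_right (hR y hy) (norm_nonneg a))
      have h3 : ‖y‖ ^ 2 ≤ R ^ 2 := pow_le_pow_left₀ (norm_nonneg y) (hR y hy) 2
      have h4 : -(|μ - δ / 2 ^ n| * R ^ 2) ≤ (μ - δ / 2 ^ n) * ‖y‖ ^ 2 := by
        have := neg_abs_le (μ - δ / 2 ^ n)
        have h5 := abs_nonneg (μ - δ / 2 ^ n)
        nlinarith [mul_le_mul_of_nonneg_left h3 h5,
          mul_le_mul_of_nonneg_right this (sq_nonneg ‖y‖)]
      simp only [F]
      linarith
    have hpos : 0 < δ / 2 ^ (n + 1) / 4 ^ n := by positivity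
    by_cases hx : F n a x ≤ sInf (F n a '' C) + δ / 2 ^ (n + 1) / 4 ^ n
    · refine ⟨x, le_rfl, fun y hy => hx.trans ?_⟩
      have := csInf_le hbdd (mem_image_of_mem _ hy)
      linarith
    · obtain ⟨_, ⟨z, hz, rfl⟩, hlt⟩ := exists_lt_of_csInf_lt
        (Set.Nonempty.image (F n a) ⟨x₀, hx₀⟩) (lt_add_of_pos_right _ hpos)
      refine ⟨⟨z, hz⟩, ?_, fun y hy => hlt.le.trans ?_⟩
      · push Not at hx
        exact (hlt.trans hx).le
      · have := csInf_le hbdd (mem_image_of_mem _ hy)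
        linarith
  choose z hz₁ hz₂ using pick
  let s : ℕ → C × X := fun n => Nat.rec (z 0 (μ • w) ⟨x₀, hx₀⟩, μ • w)
    (fun n t => (z (n + 1) (t.2 + (δ / 2 ^ (n + 1)) • (t.1 : X)) t.1,
      t.2 + (δ / 2 ^ (n + 1)) • (t.1 : X))) n
  let x : ℕ → X := fun n => (s n).1
  let a : ℕ → X := fun n => (s n).2
  have hxC : ∀ n, x n ∈ C := fun n => (s n).1.2
  have ha : ∀ n, a (n + 1) = a n + (δ / 2 ^ (n + 1)) • x n := fun n => rfl
  have hmin : ∀ n, ∀ y ∈ C, F n (a n) (x n) ≤ F n (a n) y + δ / 2 ^ (n + 1) / 4 ^ n := by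
    intro n
    cases n with
    | zero => exact hz₂ 0 _ _
    | succ n => exact hz₂ (n + 1) _ _
  have hdec : ∀ n, F (n + 1) (a (n + 1)) (x (n + 1)) ≤ F (n + 1) (a (n + 1)) (x n) :=
    fun n => hz₁ (n + 1) _ _
  have hstep : ∀ n, dist (x n) (x (n + 1)) ≤ 1 * (1 / 2) ^ n := by
    intro n
    have h1 := hdec n
    have h2 := hmin n (x (n + 1)) (hxC (n + 1))
    have hpos : 0 < δ / 2 ^ (n + 1) := by positivity
    have hhalf : δ / 2 ^ n = 2 * (δ / 2 ^ (n + 1)) := by rw [pow_succ]; field_simp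
    simp only [F, ha, hhalf, inner_add_right, inner_smul_right, real_inner_self_eq_norm_sq]
      at h1 h2
    have h3 := norm_sub_sq_real (x (n + 1)) (x n)
    have h4 : δ / 2 ^ (n + 1) * ‖x (n + 1) - x n‖ ^ 2 ≤ δ / 2 ^ (n + 1) * (1 / 4 ^ n) := by
      rw [h3]
      have : δ / 2 ^ (n + 1) / 4 ^ n = δ / 2 ^ (n + 1) * (1 / 4 ^ n) := by ring
      rw [this] at h2
      linarith
    have h5 := le_of_mul_le_mul_left h4 hpos
    rw [dist_comm, dist_eq_norm, one_mul]
    refine le_of_sq_le_sq ?_ (by positivity)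
    calc ‖x (n + 1) - x n‖ ^ 2 ≤ 1 / 4 ^ n := h5
      _ = ((1 / 2) ^ n) ^ 2 := by rw [← pow_mul, mul_comm, pow_mul, ← one_div_pow]; norm_num
  obtain ⟨xl, hxl⟩ := cauchySeq_tendsto_of_complete
    (cauchySeq_of_le_geometric (1 / 2) 1 (by norm_num) hstep)
  have hastep : ∀ n, dist (a n) (a (n + 1)) ≤ δ * R / 2 / 2 ^ n := by
    intro n
    rw [ha, dist_self_add_right, norm_smul, Real.norm_of_nonneg (by positivity), pow_succ]
    calc δ / (2 ^ n * 2) * ‖x n‖ ≤ δ / (2 ^ n * 2) * R :=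
          mul_le_mul_of_nonneg_left (hR _ (hxC n)) (by positivity)
      _ = _ := by field_simp
  obtain ⟨al, hal⟩ := cauchySeq_tendsto_of_complete (cauchySeq_of_le_geometric_two hastep)
  have hal0 : ‖al - μ • w‖ ≤ μ * η := by
    rw [← dist_eq_norm, dist_comm]
    exact (dist_le_of_le_geometric_two_of_tendsto₀ hastep hal).trans hδR
  have hinv : Tendsto (fun n : ℕ => δ / 2 ^ n) atTop (𝓝 0) := by
    have := (tendsto_pow_atTop_nhds_zero_of_lt_one (r := (1 / 2 : ℝ)) (by norm_num)
      (by norm_num)).const_mul δ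
    simpa [div_eq_mul_inv] using this
  have herr : Tendsto (fun n : ℕ => δ / 2 ^ (n + 1) / 4 ^ n) atTop (𝓝 0) := by
    refine squeeze_zero (fun n => by positivity) (fun n => ?_) hinv
    rw [div_div]
    gcongr
    calc (2 : ℝ) ^ n ≤ 2 ^ (n + 1) := by gcongr <;> simp
      _ ≤ 2 ^ (n + 1) * 4 ^ n := le_mul_of_one_le_right (by positivity)
          (one_le_pow₀ (by norm_num))
  have hkey : ∀ y ∈ C, xl ∈ C ∧
      f xl ≤ f y + μ * ‖y‖ ^ 2 - 2 * ⟪y, al⟫ - (μ * ‖xl‖ ^ 2 - 2 * ⟪xl, al⟫) := by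
    intro y hy
    have hlim : Tendsto (fun n => F n (a n) y + δ / 2 ^ (n + 1) / 4 ^ n
        - ((μ - δ / 2 ^ n) * ‖x n‖ ^ 2 - 2 * ⟪x n, a n⟫)) atTop
        (𝓝 (f y + (μ - 0) * ‖y‖ ^ 2 - 2 * ⟪y, al⟫ + 0
          - ((μ - 0) * ‖xl‖ ^ 2 - 2 * ⟪xl, al⟫))) :=
      ((((tendsto_const_nhds.add ((tendsto_const_nhds.sub hinv).mul_const _)).sub
        ((tendsto_const_nhds.inner hal).const_mul 2)).add herr).sub
        (((tendsto_const_nhds.sub hinv).mul (hxl.norm.pow 2)).sub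
          ((hxl.inner hal).const_mul 2)))
    rw [sub_zero, add_zero] at hlim
    have hmem : ∀ ε > 0, xl ∈ C ∧ f xl ≤ f y + μ * ‖y‖ ^ 2 - 2 * ⟪y, al⟫
        - (μ * ‖xl‖ ^ 2 - 2 * ⟪xl, al⟫) + ε := by
      intro ε hε
      refine (hcl _).mem_of_tendsto hxl ?_
      filter_upwards [hlim.eventually_lt_const (lt_add_of_pos_right _ hε)] with n hn
      refine ⟨hxC n, le_trans ?_ hn.le⟩
      have := hmin n y hy
      simp only [F] at this ⊢
      linarith
    exact ⟨(hmem 1 one_pos).1, le_of_forall_pos_le_add fun ε hε => (hmem ε hε).2⟩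
  refine ⟨μ⁻¹ • al, ?_, xl, (hkey x₀ hx₀).1, fun y hy => ?_⟩
  · have : μ⁻¹ • al - w = μ⁻¹ • (al - μ • w) := by
      rw [smul_sub, inv_smul_smul₀ hμ.ne']
    rw [this, norm_smul, Real.norm_of_nonneg (by positivity), inv_mul_le_iff₀ hμ]
    exact hal0
  · have h1 := (hkey y hy).2
    rw [norm_sub_sq_real, norm_sub_sq_real, inner_smul_right, inner_smul_right]
    have e : ∀ t b c : ℝ, μ * (b - 2 * (μ⁻¹ * t) + c) = μ * b - 2 * t + μ * c := by
      intro t b c; field_simp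
    rw [e, e]
    linarith

/-- Density of the centers `w'` for which `f + μ ‖· - w'‖ ^ 2` attains its minimum over a closed
ball. -/
theorem exists_center_minimizer [CompleteSpace X] {f : X → EReal} (hf : LowerSemicontinuous f)
    {x₀ : X} {ρ : ℝ} {m : ℝ} (hm : ∀ x ∈ closedBall x₀ ρ, (m : EReal) ≤ f x)
    {x₁ : X} (hx₁ : x₁ ∈ closedBall x₀ ρ) (hfx₁ : f x₁ ≠ ⊤)
    {μ : ℝ} (hμ : 0 < μ) (w : X) {η : ℝ} (hη : 0 < η) :
    ∃ w', ‖w' - w‖ ≤ η ∧ ∃ x ∈ closedBall x₀ ρ, ∃ b : ℝ, f x = b ∧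
      ∀ y ∈ closedBall x₀ ρ, ∀ c : ℝ, f y ≤ c → b + μ * ‖x - w'‖ ^ 2 ≤ c + μ * ‖y - w'‖ ^ 2 := by
  have hreal : ∀ y ∈ closedBall x₀ ρ, f y ≠ ⊤ → ((f y).toReal : EReal) = f y := fun y hy h =>
    EReal.coe_toReal h (ne_of_gt ((EReal.bot_lt_coe m).trans_le (hm y hy)))
  set α := (f x₁).toReal with hα
  have hα' : f x₁ = α := (hreal _ hx₁ hfx₁).symm
  set M : ℝ := α + μ * (‖x₁ - w‖ + η) ^ 2 with hM
  let C : Set X := {x | x ∈ closedBall x₀ ρ ∧ f x ≤ M}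
  have hCtop : ∀ x ∈ C, f x ≠ ⊤ := fun x hx h => by
    have := hx.2
    rw [h] at this
    exact EReal.coe_ne_top M (top_le_iff.mp this)
  have hx₁C : x₁ ∈ C := ⟨hx₁, by
    rw [hα', EReal.coe_le_coe_iff, hM]; exact le_add_of_nonneg_right (by positivity)⟩
  obtain ⟨w', hw', x, hxC, hx⟩ := exists_center_minimizer_real (C := C) ⟨x₁, hx₁C⟩
    (R := ‖x₀‖ + ρ) (fun x hx => by
      have h := mem_closedBall_iff_norm.mp hx.1
      calc ‖x‖ = ‖x₀ + (x - x₀)‖ := by rw [add_sub_cancel]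
        _ ≤ ‖x₀‖ + ‖x - x₀‖ := norm_add_le _ _
        _ ≤ _ := by linarith)
    (fun x => (f x).toReal) (m := m)
    (fun x hx => by
      rw [← EReal.coe_le_coe_iff, hreal x hx.1 (hCtop x hx)]
      exact hm x hx.1)
    (fun t => by
      have : {x | x ∈ C ∧ (f x).toReal ≤ t} = closedBall x₀ ρ ∩ f ⁻¹' Iic (M : EReal)
          ∩ f ⁻¹' Iic (t : EReal) := by
        ext x
        constructor
        · rintro ⟨hx, ht⟩
          refine ⟨hx, ?_⟩
          rw [← EReal.coe_le_coe_iff, hreal x hx.1 (hCtop x hx)] at ht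
          exact ht
        · rintro ⟨hx, ht⟩
          refine ⟨hx, ?_⟩
          rw [← EReal.coe_le_coe_iff, hreal x hx.1 (hCtop x hx)]
          exact ht
      rw [this]
      exact (isClosed_closedBall.inter (hf.isClosed_preimage _)).inter (hf.isClosed_preimage _))
    hμ w hη
  refine ⟨w', hw', x, hxC.1, (f x).toReal, (hreal x hxC.1 (hCtop x hxC)).symm, ?_⟩
  intro y hy c hc
  by_cases hyM : f y ≤ M
  · have h1 := hx y ⟨hy, hyM⟩
    rw [← hreal y hy (hCtop y ⟨hy, hyM⟩), EReal.coe_le_coe_iff] at hc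
    linarith
  · have h1 := hx x₁ hx₁C
    have h2 : M < c := by
      rw [← EReal.coe_lt_coe_iff]; exact (not_le.mp hyM).trans_le hc
    have h3 : ‖x₁ - w'‖ ≤ ‖x₁ - w‖ + η := by
      calc ‖x₁ - w'‖ = ‖(x₁ - w) - (w' - w)‖ := by congr 1; abel
        _ ≤ ‖x₁ - w‖ + ‖w' - w‖ := norm_sub_le _ _
        _ ≤ _ := by linarith
    have h4 : μ * ‖x₁ - w'‖ ^ 2 ≤ μ * (‖x₁ - w‖ + η) ^ 2 := by gcongr
    have h5 : 0 ≤ μ * ‖y - w'‖ ^ 2 := by positivity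
    linarith

theorem regSubdiff_subset_limSubdiff (h : X → EReal) (x : X) :
    regSubdiff h x ⊆ limSubdiff h x := fun v hv =>
  ⟨fun _ => x, fun _ => v, tendsto_const_nhds, tendsto_const_nhds, fun _ => hv,
    fun _ => tendsto_const_nhds⟩

/-- Fermat rule for a local minimizer of `h + (2 lam)⁻¹ ‖· - w‖ ^ 2`. -/
theorem inv_smul_sub_mem_regSubdiff {h : X → EReal} (hbot : ∀ x, h x ≠ ⊥) {x w : X} {b lam : ℝ}
    (hlam : 0 < lam) (hb : h x = b)
    (hmin : ∀ᶠ y in 𝓝 x, ∀ c : ℝ, h y ≤ c →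
      b + (2 * lam)⁻¹ * ‖x - w‖ ^ 2 ≤ c + (2 * lam)⁻¹ * ‖y - w‖ ^ 2) :
    lam⁻¹ • (w - x) ∈ regSubdiff h x := by
  refine ⟨by rw [hb]; exact EReal.coe_ne_top b, hbot x, fun ε hε => ?_⟩
  filter_upwards [hmin, ball_mem_nhds x (show 0 < 2 * lam * ε by positivity)] with u hu hub
  rcases eq_or_ne (h u) ⊤ with htop | htop
  · rw [htop]; exact le_top
  have hc := EReal.coe_toReal htop (hbot u)
  have h1 := hu (h u).toReal hc.ge
  rw [← hc, hb, ← EReal.coe_add, EReal.coe_le_coe_iff]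
  rw [mem_ball_iff_norm] at hub
  have h2 : ‖u - w‖ ^ 2 = ‖u - x‖ ^ 2 - 2 * ⟪w - x, u - x⟫ + ‖x - w‖ ^ 2 := by
    rw [show u - w = (u - x) - (w - x) by abel, norm_sub_sq_real, real_inner_comm,
      norm_sub_rev w x]
  rw [h2] at h1
  rw [real_inner_smul_left]
  have h3 : (2 * lam)⁻¹ * ‖u - x‖ ^ 2 ≤ ε * ‖u - x‖ := by
    rw [sq, ← mul_assoc]
    refine mul_le_mul_of_nonneg_right ?_ (norm_nonneg _)
    rw [inv_mul_le_iff₀ (by positivity)]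
    linarith
  have h4 : (2 * lam)⁻¹ * (2 * ⟪w - x, u - x⟫) = lam⁻¹ * ⟪w - x, u - x⟫ := by
    field_simp
  nlinarith

/-- The prox-regularity inequality with constant `r`, localized to the `ε`-balls around `xb`
and `vh`. -/
def ProxIneq (h : X → EReal) (xb vh : X) (r ε : ℝ) : Prop :=
  ∀ x u v, ‖x - xb‖ < ε → ‖u - xb‖ < ε → ‖v - vh‖ < ε → v ∈ limSubdiff h u →
    h u + ((⟪v, x - u⟫ - r / 2 * ‖x - u‖ ^ 2 : ℝ) : EReal) ≤ h x

theorem ProxIneq.ne_top {h : X → EReal} {xb vh : X} {r ε : ℝ} (H : ProxIneq h xb vh r ε)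
    {u v : X} (hu : ‖u - xb‖ < ε) (hv : ‖v - vh‖ < ε) (huv : v ∈ limSubdiff h u) : h u ≠ ⊤ := by
  intro htop
  obtain ⟨xs, vs, hxs, -, hreg, -⟩ := id huv
  have hmem : ∀ᶠ k in atTop, ‖xs k - xb‖ < ε :=
    (hxs.sub_const xb).norm.eventually_lt_const hu
  obtain ⟨k, hk⟩ := hmem.exists
  have h1 := H (xs k) u v hk hu hv huv
  rw [htop, EReal.top_add_coe, top_le_iff] at h1
  exact (hreg k).1 h1

theorem ProxIneq.real_le {h : X → EReal} {xb vh : X} {r ε : ℝ} (H : ProxIneq h xb vh r ε)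
    {x u v : X} {b c : ℝ} (hx : ‖x - xb‖ < ε) (hu : ‖u - xb‖ < ε) (hv : ‖v - vh‖ < ε)
    (huv : v ∈ limSubdiff h u) (hb : h u = b) (hc : h x = c) :
    b + (⟪v, x - u⟫ - r / 2 * ‖x - u‖ ^ 2) ≤ c := by
  have h1 := H x u v hx hu hv huv
  rwa [hb, hc, ← EReal.coe_add, EReal.coe_le_coe_iff] at h1

/-- Prox-regularity makes the localized subdifferential hypomonotone. -/
theorem ProxIneq.hypomonotone {h : X → EReal} (hbot : ∀ x, h x ≠ ⊥) {xb vh : X} {r ε : ℝ}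
    (H : ProxIneq h xb vh r ε) {x₁ x₂ v₁ v₂ : X}
    (hx₁ : ‖x₁ - xb‖ < ε) (hv₁ : ‖v₁ - vh‖ < ε) (h₁ : v₁ ∈ limSubdiff h x₁)
    (hx₂ : ‖x₂ - xb‖ < ε) (hv₂ : ‖v₂ - vh‖ < ε) (h₂ : v₂ ∈ limSubdiff h x₂) :
    -(r * ‖x₁ - x₂‖ ^ 2) ≤ ⟪v₁ - v₂, x₁ - x₂⟫ := by
  have e₁ := (EReal.coe_toReal (H.ne_top hx₁ hv₁ h₁) (hbot x₁)).symm
  have e₂ := (EReal.coe_toReal (H.ne_top hx₂ hv₂ h₂) (hbot x₂)).symm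
  have i₁ := H.real_le hx₂ hx₁ hv₁ h₁ e₁ e₂
  have i₂ := H.real_le hx₁ hx₂ hv₂ h₂ e₂ e₁
  rw [norm_sub_rev, ← neg_sub x₁ x₂, inner_neg_right] at i₁
  rw [inner_sub_left]
  linarith

theorem ProxIneq.resolvent_inner {h : X → EReal} (hbot : ∀ x, h x ≠ ⊥) {xb vh : X} {r ε lam : ℝ}
    (hlam : 0 ≤ lam) (H : ProxIneq h xb vh r ε) {x₁ x₂ v₁ v₂ : X}
    (hx₁ : ‖x₁ - xb‖ < ε) (hv₁ : ‖v₁ - vh‖ < ε) (h₁ : v₁ ∈ limSubdiff h x₁)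
    (hx₂ : ‖x₂ - xb‖ < ε) (hv₂ : ‖v₂ - vh‖ < ε) (h₂ : v₂ ∈ limSubdiff h x₂) :
    (1 - lam * r) * ‖x₁ - x₂‖ ^ 2 ≤ ⟪(x₁ + lam • v₁) - (x₂ + lam • v₂), x₁ - x₂⟫ := by
  have h0 := mul_le_mul_of_nonneg_left (H.hypomonotone hbot hx₁ hv₁ h₁ hx₂ hv₂ h₂) hlam
  rw [show (x₁ + lam • v₁) - (x₂ + lam • v₂) = (x₁ - x₂) + lam • (v₁ - v₂) by
    rw [smul_sub]; abel, inner_add_left, real_inner_smul_left, real_inner_self_eq_norm_sq]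
  linarith

theorem mul_norm_le_of_mul_sq_le_inner {σ : ℝ} {d e : X} (hd : σ * ‖d‖ ^ 2 ≤ ⟪e, d⟫) :
    σ * ‖d‖ ≤ ‖e‖ := by
  rcases (norm_nonneg d).eq_or_lt with h0 | h0
  · rw [← h0, mul_zero]; exact norm_nonneg e
  · refine le_of_mul_le_mul_right ?_ h0
    calc σ * ‖d‖ * ‖d‖ = σ * ‖d‖ ^ 2 := by ring
      _ ≤ ⟪e, d⟫ := hd
      _ ≤ ‖e‖ * ‖d‖ := real_inner_le_norm e d

theorem norm_sub_smul_le_of_mul_sq_le_inner {σ : ℝ} (hσ : 0 ≤ σ) {d e : X}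
    (hd : σ * ‖d‖ ^ 2 ≤ ⟪e, d⟫) : ‖e - (2 * σ) • d‖ ≤ ‖e‖ := by
  refine le_of_sq_le_sq ?_ (norm_nonneg e)
  rw [norm_sub_sq_real, norm_smul, real_inner_smul_right, Real.norm_of_nonneg (by positivity)]
  nlinarith [mul_le_mul_of_nonneg_left hd hσ]

/-- Closedness of the subdifferential along regular subgradients converging strongly. -/
theorem ProxIneq.mem_limSubdiff_of_tendsto {h : X → EReal} (hlsc : LowerSemicontinuous h)
    (hbot : ∀ x, h x ≠ ⊥) {xb vh : X} {r ε : ℝ} (H : ProxIneq h xb vh r ε)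
    {xs vs : ℕ → X} {x v : X} (hxs : Tendsto xs atTop (𝓝 x)) (hvs : Tendsto vs atTop (𝓝 v))
    (hreg : ∀ k, vs k ∈ regSubdiff h (xs k)) (hx : ‖x - xb‖ < ε) (hxsε : ∀ k, ‖xs k - xb‖ < ε)
    (hvsε : ∀ k, ‖vs k - vh‖ < ε) : v ∈ limSubdiff h x := by
  refine ⟨xs, vs, hxs, ?_, hreg, fun z => hvs.inner tendsto_const_nhds⟩
  refine tendsto_order.2 ⟨fun a ha => hxs.eventually (hlsc x a ha), fun a ha => ?_⟩
  have hc := EReal.coe_toReal ha.ne_top (hbot x)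
  have hlim : Tendsto (fun k => (h x).toReal - (⟪vs k, x - xs k⟫ - r / 2 * ‖x - xs k‖ ^ 2)) atTop
      (𝓝 ((h x).toReal - (⟪v, x - x⟫ - r / 2 * ‖x - x‖ ^ 2))) :=
    tendsto_const_nhds.sub ((hvs.inner (tendsto_const_nhds.sub hxs)).sub
      (((tendsto_const_nhds.sub hxs).norm.pow 2).const_mul _))
  simp only [sub_self, inner_zero_right, norm_zero, ne_eq, OfNat.ofNat_ne_zero, not_false_eq_true,
    zero_pow, mul_zero, sub_zero] at hlim
  have hlim' := (continuous_coe_real_ereal.tendsto _).comp hlim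
  rw [hc] at hlim'
  filter_upwards [hlim'.eventually_lt_const ha] with k hk
  refine lt_of_le_of_lt ?_ hk
  have hk' := (EReal.coe_toReal (hreg k).1 (hreg k).2.1).symm
  have := H.real_le hx (hxsε k) (hvsε k) (regSubdiff_subset_limSubdiff h _ (hreg k)) hk' hc.symm
  rw [hk', Function.comp_apply, EReal.coe_le_coe_iff]
  linarith

/-- A proximal point of a center close to `w`, with a regular subgradient, when a limiting
subgradient `vp` at `xp` near the reference point is available. -/
theorem ProxIneq.exists_regular_resolvent [CompleteSpace X] {h : X → EReal}
    (hlsc : LowerSemicontinuous h) (hbot : ∀ x, h x ≠ ⊥) {xb vh : X} {r ε lam : ℝ}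
    (H : ProxIneq h xb vh r ε) (hlam : 0 < lam) (hlr : lam * r < 1) {xp vp w : X} {ρ η : ℝ}
    (hη : 0 < η) (hρε : ρ < ε) (hv : ‖vp - vh‖ < ε) (hvp : vp ∈ limSubdiff h xp)
    (hρ : ‖xp - xb‖ + 2 / (1 - lam * r) * (‖w - (xp + lam • vp)‖ + η) < ρ) :
    ∃ w' x, ‖w' - w‖ ≤ η ∧ ‖x - xb‖ < ρ ∧ lam⁻¹ • (w' - x) ∈ regSubdiff h x := by
  have hσ : 0 < 1 - lam * r := by linarith
  have hxpρ : ‖xp - xb‖ < ρ := lt_of_le_of_lt (le_add_of_nonneg_right (by positivity)) hρ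
  have hxp : ‖xp - xb‖ < ε := hxpρ.trans hρε
  have hα := (EReal.coe_toReal (H.ne_top hxp hv hvp) (hbot xp)).symm
  set α := (h xp).toReal
  have hlow : ∀ x ∈ closedBall xb ρ,
      ((α - ‖vp‖ * (2 * ρ) - |r / 2| * (2 * ρ) ^ 2 : ℝ) : EReal) ≤ h x := by
    intro x hx
    rw [mem_closedBall_iff_norm] at hx
    refine le_trans ?_ (H x xp vp (hx.trans_lt hρε) hxp hv hvp)
    rw [hα, ← EReal.coe_add, EReal.coe_le_coe_iff]
    have h1 : ‖x - xp‖ ≤ 2 * ρ := by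
      calc ‖x - xp‖ = ‖(x - xb) - (xp - xb)‖ := by congr 1; abel
        _ ≤ ‖x - xb‖ + ‖xp - xb‖ := norm_sub_le _ _
        _ ≤ 2 * ρ := by linarith
    have h2 : |⟪vp, x - xp⟫| ≤ ‖vp‖ * (2 * ρ) :=
      (abs_real_inner_le_norm _ _).trans (by gcongr)
    have h3 : r / 2 * ‖x - xp‖ ^ 2 ≤ |r / 2| * (2 * ρ) ^ 2 :=
      (mul_le_mul_of_nonneg_right (le_abs_self _) (by positivity)).trans (by gcongr)
    linarith [(abs_le.mp h2).1]
  obtain ⟨w', hw', x, hxB, b, hb, hmin⟩ := exists_center_minimizer hlsc hlow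
    (mem_closedBall_iff_norm.mpr hxpρ.le) (H.ne_top hxp hv hvp)
    (show 0 < (2 * lam)⁻¹ by positivity) w hη
  have hd : (1 - lam * r) * ‖x - xp‖ ^ 2 ≤ ⟪(2 : ℝ) • (w' - (xp + lam • vp)), x - xp⟫ := by
    have h1 := hmin xp (mem_closedBall_iff_norm.mpr hxpρ.le) α hα.le
    have h2 := H.real_le ((mem_closedBall_iff_norm.mp hxB).trans_lt hρε) hxp hv hvp hα hb
    have h3 : ‖x - w'‖ ^ 2 = ‖x - xp‖ ^ 2 - 2 * ⟪w' - xp, x - xp⟫ + ‖xp - w'‖ ^ 2 := by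
      rw [show x - w' = (x - xp) - (w' - xp) by abel, norm_sub_sq_real, real_inner_comm,
        norm_sub_rev w' xp]
    rw [real_inner_smul_left, show w' - (xp + lam • vp) = (w' - xp) - lam • vp by abel,
      inner_sub_left, real_inner_smul_left]
    have h4 : (2 * lam)⁻¹ * (‖x - xp‖ ^ 2 - 2 * ⟪w' - xp, x - xp⟫)
        ≤ r / 2 * ‖x - xp‖ ^ 2 - ⟪vp, x - xp⟫ := by
      rw [h3] at h1; linarith
    rw [inv_mul_le_iff₀ (by positivity)] at h4
    linarith
  have hxρ : ‖x - xb‖ < ρ := by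
    have h1 := mul_norm_le_of_mul_sq_le_inner hd
    have h2 : ‖w' - (xp + lam • vp)‖ ≤ ‖w - (xp + lam • vp)‖ + η := by
      calc ‖w' - (xp + lam • vp)‖ = ‖(w - (xp + lam • vp)) + (w' - w)‖ := by congr 1; abel
        _ ≤ _ := (norm_add_le _ _).trans (by linarith)
    rw [norm_smul, Real.norm_two] at h1
    have h3 : ‖x - xp‖ ≤ 2 / (1 - lam * r) * (‖w - (xp + lam • vp)‖ + η) := by
      rw [div_mul_eq_mul_div, le_div_iff₀ hσ]
      linarith
    calc ‖x - xb‖ = ‖(xp - xb) + (x - xp)‖ := by congr 1; abel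
      _ ≤ ‖xp - xb‖ + ‖x - xp‖ := norm_add_le _ _
      _ < ρ := by linarith
  refine ⟨w', x, hw', hxρ, inv_smul_sub_mem_regSubdiff hbot hlam hb ?_⟩
  filter_upwards [closedBall_mem_nhds_of_mem (mem_ball_iff_norm.mpr hxρ)] with y hy
  exact hmin y hy

theorem norm_inv_smul_sub_sub_lt {xb vh w x : X} {lam ε : ℝ} (hlam : 0 < lam)
    (hlt : ‖w - (xb + lam • vh)‖ + ‖x - xb‖ < lam * ε) : ‖lam⁻¹ • (w - x) - vh‖ < ε := by
  rw [show lam⁻¹ • (w - x) - vh = lam⁻¹ • ((w - (xb + lam • vh)) - (x - xb)) by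
    rw [show (w - (xb + lam • vh)) - (x - xb) = (w - x) - lam • vh by abel, smul_sub _ (w - x),
      inv_smul_smul₀ hlam.ne'], norm_smul, Real.norm_of_nonneg (by positivity),
    inv_mul_lt_iff₀ hlam]
  exact (norm_sub_le _ _).trans_lt hlt

/-- Solvability of the proximal inclusion near the reference point. -/
theorem ProxIneq.exists_resolvent [CompleteSpace X] {h : X → EReal}
    (hlsc : LowerSemicontinuous h) (hbot : ∀ x, h x ≠ ⊥) {xb vh : X} {r ε lam : ℝ}
    (H : ProxIneq h xb vh r ε) (hlam : 0 < lam) (hlr : lam * r < 1) {xp vp w : X} {ρ η : ℝ}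
    (hη : 0 < η) (hρε : ρ < ε) (hv : ‖vp - vh‖ < ε) (hvp : vp ∈ limSubdiff h xp)
    (hρ : ‖xp - xb‖ + 2 / (1 - lam * r) * (‖w - (xp + lam • vp)‖ + η) < ρ)
    (hw : ‖w - (xb + lam • vh)‖ + η + ρ ≤ lam * ε) :
    ∃ x, ‖x - xb‖ ≤ ρ ∧ lam⁻¹ • (w - x) ∈ limSubdiff h x := by
  have hσ : 0 < 1 - lam * r := by linarith
  have hηk : ∀ k : ℕ, η / (k + 1) ≤ η := fun k =>
    div_le_self hη.le (le_add_of_nonneg_left (Nat.cast_nonneg k))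
  have hex : ∀ k : ℕ, ∃ w' x, ‖w' - w‖ ≤ η / (k + 1) ∧ ‖x - xb‖ < ρ ∧
      lam⁻¹ • (w' - x) ∈ regSubdiff h x := by
    intro k
    refine H.exists_regular_resolvent hlsc hbot hlam hlr (by positivity) hρε hv hvp
      (lt_of_le_of_lt ?_ hρ)
    have := hηk k
    gcongr
  choose ws xs hws hxs hreg using hex
  have hxsε : ∀ k, ‖xs k - xb‖ < ε := fun k => (hxs k).trans hρε
  have hvsε : ∀ k, ‖lam⁻¹ • (ws k - xs k) - vh‖ < ε := by
    intro k
    refine norm_inv_smul_sub_sub_lt (xb := xb) hlam ?_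
    have h1 : ‖ws k - (xb + lam • vh)‖ ≤ ‖w - (xb + lam • vh)‖ + η := by
      calc ‖ws k - (xb + lam • vh)‖ = ‖(w - (xb + lam • vh)) + (ws k - w)‖ := by congr 1; abel
        _ ≤ _ := (norm_add_le _ _).trans (by linarith [hws k, hηk k])
    linarith [hxs k]
  have hdist : ∀ j k, (1 - lam * r) * ‖xs j - xs k‖ ≤ ‖ws j - ws k‖ := by
    intro j k
    have h1 := mul_norm_le_of_mul_sq_le_inner (H.resolvent_inner hbot hlam.le
      (hxsε j) (hvsε j) (regSubdiff_subset_limSubdiff h _ (hreg j))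
      (hxsε k) (hvsε k) (regSubdiff_subset_limSubdiff h _ (hreg k)))
    rwa [smul_inv_smul₀ hlam.ne', smul_inv_smul₀ hlam.ne', add_sub_cancel, add_sub_cancel] at h1
  have herr : Tendsto (fun k : ℕ => η / ((k : ℝ) + 1)) atTop (𝓝 0) := by
    have := (tendsto_one_div_add_atTop_nhds_zero_nat (𝕜 := ℝ)).const_mul η
    simpa [div_eq_mul_inv] using this
  have hwlim : Tendsto ws atTop (𝓝 w) :=
    tendsto_iff_norm_sub_tendsto_zero.mpr (squeeze_zero (fun _ => norm_nonneg _) hws herr)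
  have hcauchy : CauchySeq xs := by
    refine cauchySeq_of_le_tendsto_0 (fun N : ℕ => 2 * (η / ((N : ℝ) + 1)) / (1 - lam * r)) ?_ ?_
    · intro n m N hn hm
      have hN : ∀ k, N ≤ k → ‖ws k - w‖ ≤ η / ((N : ℝ) + 1) := fun k hk =>
        (hws k).trans (by gcongr)
      rw [dist_eq_norm, le_div_iff₀ hσ, mul_comm]
      refine (hdist n m).trans ?_
      calc ‖ws n - ws m‖ = ‖(ws n - w) - (ws m - w)‖ := by congr 1; abel
        _ ≤ ‖ws n - w‖ + ‖ws m - w‖ := norm_sub_le _ _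
        _ ≤ _ := by linarith [hN n hn, hN m hm]
    · simpa using (herr.const_mul 2).div_const (1 - lam * r)
  obtain ⟨x, hx⟩ := cauchySeq_tendsto_of_complete hcauchy
  have hxρ : ‖x - xb‖ ≤ ρ :=
    le_of_tendsto (hx.sub_const xb).norm (Eventually.of_forall fun k => (hxs k).le)
  exact ⟨x, hxρ, H.mem_limSubdiff_of_tendsto hlsc hbot hx ((hwlim.sub hx).const_smul lam⁻¹) hreg
    (hxρ.trans_lt hρε) hxsε hvsε⟩

theorem norm_le_of_prod_norm_sub_le {E : Type*} [SeminormedAddCommGroup E] {x x' s s' : E} {t : ℝ}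
    (h : ‖(x, s) - (x', s')‖ ≤ t) :
    ‖x - x'‖ ≤ t ∧ ‖s - s'‖ ≤ t :=
  ⟨(norm_fst_le ((x, s) - (x', s'))).trans h, (norm_snd_le ((x, s) - (x', s'))).trans h⟩

/-- A Lipschitz localization of the proximal mapping makes the graphical subdifferential map
Lipschitz-like. -/
theorem lipschitzLike_gphMap_of_localization {P : Type*} [MetricSpace P] {g : X → P → EReal}
    {xb vh : X} {pb : P} {lam κ ℓ : ℝ} (hlam : 0 < lam) (hκ : 0 < κ) (hℓ : 0 < ℓ)
    {Wn U : Set X} {Pn : Set P} (hWn : Wn ∈ 𝓝 (lam • vh + xb)) (hPn : Pn ∈ 𝓝 pb) (hU : U ∈ 𝓝 xb)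
    {π : X → P → X} (hπ : Localizes2 (proxMap g lam) Wn Pn U π)
    (hlip : ∀ v₁ ∈ Wn, ∀ p₁ ∈ Pn, ∀ v₂ ∈ Wn, ∀ p₂ ∈ Pn,
      ‖(v₁ - v₂) - (2 * κ) • (π v₁ p₁ - π v₂ p₂)‖ ≤ ‖v₁ - v₂‖ + ℓ * dist p₁ p₂) :
    LipschitzLike (fun p => gphMap g p) pb (xb, vh) := by
  have hcont : Continuous fun t : X × X => lam • t.2 + t.1 := by fun_prop
  refine ⟨max 1 lam⁻¹ * (ℓ / (2 * κ)), by positivity, Pn, hPn,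
    (fun t : X × X => lam • t.2 + t.1) ⁻¹' Wn ∩ Prod.fst ⁻¹' U,
    inter_mem (hcont.continuousAt.preimage_mem_nhds hWn)
      (continuous_fst.continuousAt.preimage_mem_nhds hU), ?_⟩
  rintro p hp p' hp' ⟨x, s⟩ ⟨hxs, hw, hx⟩
  change s ∈ pSubdiff g x p at hxs
  change lam • s + x ∈ Wn at hw
  set w := lam • s + x with hwdef
  have hxw : x = π w p := (hπ w hw p hp).2.2 x hx ⟨s, hxs, add_comm _ _⟩
  obtain ⟨-, ⟨s', hs', hws'⟩, -⟩ := hπ w hw p' hp'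
  have hd : ‖x - π w p'‖ ≤ ℓ / (2 * κ) * dist p p' := by
    have h1 := hlip w hw p hp w hw p' hp'
    rw [← hxw, sub_self, norm_zero, zero_sub, norm_neg, zero_add, norm_smul,
      Real.norm_of_nonneg (by positivity)] at h1
    rw [div_mul_eq_mul_div, le_div_iff₀ (by positivity)]
    linarith
  refine ⟨(π w p', s'), hs', ?_⟩
  have hs : ‖s - s'‖ = lam⁻¹ * ‖x - π w p'‖ := by
    have h1 : lam • (s - s') = -(x - π w p') := by
      have h2 : lam • s' = w - π w p' := eq_sub_of_add_eq' hws'.symm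
      rw [smul_sub, h2, hwdef]
      abel
    rw [← norm_neg (x - π w p'), ← h1, norm_smul, Real.norm_of_nonneg hlam.le,
      inv_mul_cancel_left₀ hlam.ne']
  rw [Prod.mk_sub_mk, Prod.norm_mk, mul_assoc]
  refine max_le ?_ ?_
  · exact hd.trans (le_mul_of_one_le_left (by positivity) (le_max_left _ _))
  · rw [hs]
    exact mul_le_mul (le_max_right _ _) hd (norm_nonneg _) (by positivity)

/-- If the graphical subdifferential map is Lipschitz-like, the proximal mapping has a Lipschitz
localization. -/
theorem exists_localization_of_lipschitzLike_gphMap [CompleteSpace X] {P : Type*} [MetricSpace P]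
    {g : X → P → EReal} {xb vh : X} {pb : P}
    (hg_lsc : LowerSemicontinuous fun t : X × P => g t.1 t.2) (hg_proper : ∀ x p, g x p ≠ ⊥)
    (hvh : vh ∈ pSubdiff g xb pb) {r lam : ℝ} (hr : ProxRegWith g xb pb vh r)
    (hlam : 0 < lam) (hr0 : 0 < r) (hlr : lam * r < 1)
    (hL : LipschitzLike (fun p => gphMap g p) pb (xb, vh)) :
    ∃ Wn ∈ 𝓝 (lam • vh + xb), ∃ Pn ∈ 𝓝 pb, ∃ U ∈ 𝓝 xb, ∃ π : X → P → X,
      Localizes2 (proxMap g lam) Wn Pn U π ∧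
      ∃ κ₀ > (0:ℝ), ∃ ℓ₀ > (0:ℝ), ∀ v₁ ∈ Wn, ∀ p₁ ∈ Pn, ∀ v₂ ∈ Wn, ∀ p₂ ∈ Pn,
        ‖(v₁ - v₂) - (2 * κ₀) • (π v₁ p₁ - π v₂ p₂)‖ ≤ ‖v₁ - v₂‖ + ℓ₀ * dist p₁ p₂ := by
  obtain ⟨ε₀, hε₀, hprox⟩ := hr
  obtain ⟨ℓ, hℓ, U₀, hU₀, V₀, hV₀, haubin⟩ := hL
  obtain ⟨ρ₁, hρ₁, hU₀⟩ := Metric.mem_nhds_iff.mp hU₀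
  obtain ⟨ρ₂, hρ₂, hV₀⟩ := Metric.mem_nhds_iff.mp hV₀
  have hσ : 0 < 1 - lam * r := by linarith
  set σ := 1 - lam * r with hσdef
  have hσ1 : σ ≤ 1 := by have := mul_pos hlam hr0; linarith
  set ε := min ε₀ ρ₂ with hεdef
  have hε : 0 < ε := lt_min hε₀ hρ₂
  set a := min (ε / 2) (lam * ε / 4) with hadef
  have ha : 0 < a := by positivity
  have haε : a ≤ ε / 2 := min_le_left _ _
  have haε' : a ≤ lam * ε / 4 := min_le_right _ _
  set b := σ * a / 16 with hbdef
  have hb : 0 < b := by positivity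
  have hba : b ≤ a / 16 := by rw [hbdef]; gcongr; exact mul_le_of_le_one_left ha.le hσ1
  set K := 1 + 2 / σ * (1 + lam) with hK
  have hK0 : 0 < K := by positivity
  set c := min (min ε₀ ρ₁) (min (a / (8 * K * ℓ)) (ε / (8 * ℓ))) with hcdef
  have hc : 0 < c := by positivity
  have hcε₀ : c ≤ ε₀ := (min_le_left _ _).trans (min_le_left _ _)
  have hcρ₁ : c ≤ ρ₁ := (min_le_left _ _).trans (min_le_right _ _)
  have hcK : K * (ℓ * c) ≤ a / 8 := by
    have : c ≤ a / (8 * K * ℓ) := (min_le_right _ _).trans (min_le_left _ _)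
    rw [le_div_iff₀ (by positivity)] at this
    linarith
  have hcε : ℓ * c ≤ ε / 8 := by
    have : c ≤ ε / (8 * ℓ) := (min_le_right _ _).trans (min_le_right _ _)
    rw [le_div_iff₀ (by positivity)] at this
    linarith
  have hbot : ∀ p x, g x p ≠ ⊥ := fun p x => hg_proper x p
  have hlsc : ∀ p, LowerSemicontinuous fun x => g x p := fun p =>
    hg_lsc.comp (Continuous.prodMk_left p)
  have H : ∀ p, dist p pb < c → ProxIneq (fun x => g x p) xb vh r ε := by
    intro p hp x u v hx hu hv huv
    exact hprox x u p v (hx.trans_le (min_le_left _ _)) (hu.trans_le (min_le_left _ _))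
      (hp.trans_le hcε₀) (hv.trans_le (min_le_left _ _)) huv
  have hnear : ∀ p p' x s, dist p pb < c → dist p' pb < c → ‖x - xb‖ < ε → ‖s - vh‖ < ε →
      s ∈ pSubdiff g x p → ∃ x' s', s' ∈ pSubdiff g x' p' ∧
        ‖x - x'‖ ≤ ℓ * dist p p' ∧ ‖s - s'‖ ≤ ℓ * dist p p' := by
    intro p p' x s hp hp' hx hs hxs
    obtain ⟨⟨x', s'⟩, hxs', hle⟩ := haubin p (hU₀ (hp.trans_le hcρ₁)) p' (hU₀ (hp'.trans_le hcρ₁))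
      (x, s) ⟨hxs, hV₀ (by
        rw [mem_ball, Prod.dist_eq, dist_eq_norm, dist_eq_norm]
        exact max_lt (hx.trans_le (min_le_right _ _)) (hs.trans_le (min_le_right _ _)))⟩
    exact ⟨x', s', hxs', norm_le_of_prod_norm_sub_le hle⟩
  have hsub : ∀ w x s, ‖w - (xb + lam • vh)‖ < b → ‖x - xb‖ < a → w = x + lam • s →
      ‖s - vh‖ < ε / 2 := by
    intro w x s hw hx hwx
    have : s = lam⁻¹ • (w - x) := by rw [hwx, add_sub_cancel_left, inv_smul_smul₀ hlam.ne']
    rw [this]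
    exact norm_inv_smul_sub_sub_lt (xb := xb) hlam (by linarith)
  have hex : ∀ w p, ‖w - (xb + lam • vh)‖ < b → dist p pb < c →
      ∃ x, ‖x - xb‖ < a ∧ x ∈ proxMap g lam w p := by
    intro w p hw hp
    obtain ⟨xp, vp, hvp, hxp', hvp'⟩ := hnear pb p xb vh (by simpa using hc) hp
      (by simpa using hε) (by simpa using hε) hvh
    have hdc : ℓ * dist pb p ≤ ℓ * c := by rw [dist_comm]; gcongr
    rw [norm_sub_rev] at hxp' hvp'
    have hwp : ‖w - (xp + lam • vp)‖ ≤ b + (1 + lam) * (ℓ * c) := by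
      calc ‖w - (xp + lam • vp)‖
          = ‖(w - (xb + lam • vh)) - ((xp - xb) + lam • (vp - vh))‖ := by
            rw [smul_sub]; congr 1; abel
        _ ≤ ‖w - (xb + lam • vh)‖ + (‖xp - xb‖ + ‖lam • (vp - vh)‖) :=
            (norm_sub_le _ _).trans (by gcongr; exact norm_add_le _ _)
        _ ≤ b + (ℓ * c + lam * (ℓ * c)) := by
            rw [norm_smul, Real.norm_of_nonneg hlam.le]
            gcongr
            · exact hxp'.trans hdc
            · exact hvp'.trans hdc
        _ = _ := by ring
    obtain ⟨x, hx, hxs⟩ := (H p hp).exists_resolvent (hlsc p) (hbot p) hlam hlr (w := w)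
      (ρ := a / 2) hb (by linarith) (hvp'.trans_lt (by linarith)) hvp (by
        calc ‖xp - xb‖ + 2 / (1 - lam * r) * (‖w - (xp + lam • vp)‖ + b)
            ≤ ℓ * c + 2 / σ * (b + (1 + lam) * (ℓ * c) + b) := by
              gcongr
              exact hxp'.trans hdc
          _ = K * (ℓ * c) + a / 4 := by rw [hK, hbdef]; field_simp; ring
          _ < a / 2 := by linarith)
      (by linarith)
    exact ⟨x, by linarith, _, hxs, by rw [smul_inv_smul₀ hlam.ne', add_sub_cancel]⟩
  have hmono : ∀ p, dist p pb < c → ∀ x₁ s₁ x₂ s₂, ‖x₁ - xb‖ < ε → ‖s₁ - vh‖ < ε →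
      ‖x₂ - xb‖ < ε → ‖s₂ - vh‖ < ε → s₁ ∈ pSubdiff g x₁ p → s₂ ∈ pSubdiff g x₂ p →
      σ * ‖x₁ - x₂‖ ^ 2 ≤ ⟪(x₁ + lam • s₁) - (x₂ + lam • s₂), x₁ - x₂⟫ :=
    fun p hp x₁ s₁ x₂ s₂ hx₁ hs₁ hx₂ hs₂ h₁ h₂ =>
      (H p hp).resolvent_inner (hbot p) hlam.le hx₁ hs₁ h₁ hx₂ hs₂ h₂
  choose! π hπ₁ hπ₂ using hex
  have hWn : ∀ w ∈ ball (lam • vh + xb) b, ‖w - (xb + lam • vh)‖ < b := by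
    intro w hw
    rwa [mem_ball_iff_norm, add_comm] at hw
  refine ⟨ball (lam • vh + xb) b, ball_mem_nhds _ hb, ball pb c, ball_mem_nhds _ hc,
    ball xb a, ball_mem_nhds _ ha, π, ?_, σ, hσ, (2 * (1 + lam) + 2 * σ) * ℓ, by positivity, ?_⟩
  · intro w hw p hp
    have hw := hWn w hw
    refine ⟨mem_ball_iff_norm.mpr (hπ₁ w p hw hp), hπ₂ w p hw hp, ?_⟩
    rintro x hx ⟨s, hs, hws⟩
    rw [mem_ball_iff_norm] at hx
    obtain ⟨s', hs', hws'⟩ := hπ₂ w p hw hp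
    have hx' := hπ₁ w p hw hp
    have h1 := mul_norm_le_of_mul_sq_le_inner (hmono p hp x s _ s' (by linarith)
      (by linarith [hsub w x s hw hx hws]) (by linarith)
      (by linarith [hsub w _ s' hw hx' hws']) hs hs')
    rw [← hws, ← hws', sub_self, norm_zero] at h1
    have h2 : ‖x - π w p‖ ≤ 0 := by
      by_contra hlt
      push Not at hlt
      exact absurd h1 (not_le.mpr (mul_pos hσ hlt))
    exact sub_eq_zero.mp (norm_le_zero_iff.mp h2)
  · intro w₁ hw₁ p₁ hp₁ w₂ hw₂ p₂ hp₂
    have hw₁ := hWn w₁ hw₁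
    have hw₂ := hWn w₂ hw₂
    have hx₁ := hπ₁ w₁ p₁ hw₁ hp₁
    have hx₂ := hπ₁ w₂ p₂ hw₂ hp₂
    obtain ⟨s₁, hs₁, hws₁⟩ := hπ₂ w₁ p₁ hw₁ hp₁
    obtain ⟨s₂, hs₂, hws₂⟩ := hπ₂ w₂ p₂ hw₂ hp₂
    have hsv₁ := hsub w₁ _ s₁ hw₁ hx₁ hws₁
    have hsv₂ := hsub w₂ _ s₂ hw₂ hx₂ hws₂
    set x₁ := π w₁ p₁
    set x₂ := π w₂ p₂
    obtain ⟨x', s', hs', hxx', hss'⟩ := hnear p₁ p₂ x₁ s₁ hp₁ hp₂ (by linarith) (by linarith) hs₁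
    have hdist : ℓ * dist p₁ p₂ ≤ ε / 4 := by
      have h1 : dist p₁ p₂ ≤ c + c :=
        (dist_triangle_right p₁ p₂ pb).trans (add_le_add (le_of_lt hp₁) (le_of_lt hp₂))
      nlinarith
    have hx'ε : ‖x' - xb‖ < ε := by
      calc ‖x' - xb‖ = ‖(x₁ - xb) - (x₁ - x')‖ := by congr 1; abel
        _ ≤ ‖x₁ - xb‖ + ‖x₁ - x'‖ := norm_sub_le _ _
        _ < ε := by linarith
    have hs'ε : ‖s' - vh‖ < ε := by
      calc ‖s' - vh‖ = ‖(s₁ - vh) - (s₁ - s')‖ := by congr 1; abel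
        _ ≤ ‖s₁ - vh‖ + ‖s₁ - s'‖ := norm_sub_le _ _
        _ < ε := by linarith
    have h1 := norm_sub_smul_le_of_mul_sq_le_inner hσ.le
      (hmono p₂ hp₂ x' s' x₂ s₂ hx'ε hs'ε (by linarith) (by linarith) hs' hs₂)
    rw [← hws₂] at h1
    set w' := x' + lam • s' with hw'
    have hww' : ‖w₁ - w'‖ ≤ (1 + lam) * (ℓ * dist p₁ p₂) := by
      calc ‖w₁ - w'‖ = ‖(x₁ - x') + lam • (s₁ - s')‖ := by
            rw [hws₁, hw', smul_sub]; congr 1; abel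
        _ ≤ ‖x₁ - x'‖ + ‖lam • (s₁ - s')‖ := norm_add_le _ _
        _ ≤ ℓ * dist p₁ p₂ + lam * (ℓ * dist p₁ p₂) := by
            rw [norm_smul, Real.norm_of_nonneg hlam.le]
            gcongr
        _ = _ := by ring
    have h2 : ‖w' - w₂‖ ≤ ‖w₁ - w₂‖ + ‖w₁ - w'‖ := by
      calc ‖w' - w₂‖ = ‖(w₁ - w₂) - (w₁ - w')‖ := by congr 1; abel
        _ ≤ _ := norm_sub_le _ _
    have h3 : ‖(2 * σ) • (x₁ - x')‖ ≤ 2 * σ * (ℓ * dist p₁ p₂) := by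
      rw [norm_smul, Real.norm_of_nonneg (by positivity)]
      gcongr
    calc ‖(w₁ - w₂) - (2 * σ) • (x₁ - x₂)‖
        = ‖((w' - w₂) - (2 * σ) • (x' - x₂)) + ((w₁ - w') - (2 * σ) • (x₁ - x'))‖ := by
          simp only [smul_sub]; congr 1; abel
      _ ≤ ‖(w' - w₂) - (2 * σ) • (x' - x₂)‖ + (‖w₁ - w'‖ + ‖(2 * σ) • (x₁ - x')‖) :=
          (norm_add_le _ _).trans (by gcongr; exact norm_sub_le _ _)
      _ ≤ ‖w₁ - w₂‖ + (2 * (1 + lam) + 2 * σ) * ℓ * dist p₁ p₂ := by linarith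

/-- Lipschitzian localization of the proximal mapping characterized
via the graphical subdifferential mapping (Theorem 6.5). -/
theorem statement9
    {X : Type*} [NormedAddCommGroup X] [InnerProductSpace ℝ X] [CompleteSpace X]
    {P : Type*} [MetricSpace P]
    (g : X → P → EReal) (xb vh : X) (pb : P)
    (hg_lsc : LowerSemicontinuous fun t : X × P => g t.1 t.2)
    (hg_proper : ∀ x p, g x p ≠ ⊥)
    (hvh : vh ∈ pSubdiff g xb pb)
    (hA2 : A2 g xb pb vh) (hA3 : A3 g xb pb) :
    (∀ lam : ℝ, 0 < lam → lam * proxThreshold g xb pb vh < 1 →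
        ∃ Wn ∈ 𝓝 (lam • vh + xb), ∃ Pn ∈ 𝓝 pb, ∃ U ∈ 𝓝 xb, ∃ π : X → P → X,
          Localizes2 (proxMap g lam) Wn Pn U π ∧
          ∃ κ₀ > (0:ℝ), ∃ ℓ₀ > (0:ℝ), ∀ v₁ ∈ Wn, ∀ p₁ ∈ Pn, ∀ v₂ ∈ Wn, ∀ p₂ ∈ Pn,
            ‖(v₁ - v₂) - (2 * κ₀) • (π v₁ p₁ - π v₂ p₂)‖
              ≤ ‖v₁ - v₂‖ + ℓ₀ * dist p₁ p₂) ↔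
      LipschitzLike (fun p => gphMap g p) pb (xb, vh) := by
  constructor
  · intro hloc
    have hthr : 0 ≤ proxThreshold g xb pb vh := Real.sInf_nonneg fun r hr => hr.1.le
    obtain ⟨Wn, hWn, Pn, hPn, U, hU, π, hπ, κ, hκ, ℓ, hℓ, hlip⟩ :=
      hloc (proxThreshold g xb pb vh + 1)⁻¹ (by positivity)
        (by rw [inv_mul_lt_iff₀ (by positivity)]; linarith)
    exact lipschitzLike_gphMap_of_localization (by positivity) hκ hℓ hWn hPn hU hπ hlip
  · intro hL lam hlam hlt
    obtain ⟨r₀, hr₀⟩ := hA2.1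
    obtain ⟨r, ⟨hr0, hr⟩, hlr⟩ := exists_lt_of_csInf_lt
      (s := {r : ℝ | 0 < r ∧ ProxRegWith g xb pb vh r}) ⟨r₀, hr₀⟩
      (show proxThreshold g xb pb vh < lam⁻¹ by rwa [← one_div, lt_div_iff₀' hlam])
    refine exists_localization_of_lipschitzLike_gphMap hg_lsc hg_proper hvh hr hlam hr0 ?_ hL
    rwa [← one_div, lt_div_iff₀' hlam] at hlr

end PVS
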